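/- The Haezendonck–Goovaerts premium principle admits the dual representation π_α(X) = sup{ E[XY] : Y ∈ L^∞, Y ≥ 0 a.s., E[Y] = 1, ‖Y‖_{Ψ_α} ≤ 1 } for every X ∈ L^Φ; equivalently, π_α(X) = sup_{ℚ ∈ Q^∞_α} E_ℚ[X], where Q^∞_α is the set of probability measures ℚ absolutely continuous with respect to ℙ whose density dℚ/dℙ is bounded and has Orlicz norm ‖dℚ/dℙ‖_{Ψ_α} ≤ 1. -/

import Mathlib

open MeasureTheory Filter Set Topology

/-- The Luxemburg norm associated with the Orlicz function `Θ`. -/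
noncomputable def luxNorm {Ω : Type*} [MeasurableSpace Ω] (μ : Measure Ω)
    (Θ : ℝ → ℝ) (X : Ω → ℝ) : ℝ :=
  sInf {l : ℝ | 0 < l ∧ ∫⁻ ω, ENNReal.ofReal (Θ (|X ω| / l)) ∂μ ≤ 1}

/-- Membership in the Orlicz space `L^Θ`. -/
def MemOrlicz {Ω : Type*} [MeasurableSpace Ω] (μ : Measure Ω)
    (Θ : ℝ → ℝ) (X : Ω → ℝ) : Prop :=
  Measurable X ∧ ∃ l : ℝ, 0 < l ∧ ∫⁻ ω, ENNReal.ofReal (Θ (|X ω| / l)) ∂μ < ⊤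

/-- The Haezendonck–Goovaerts premium principle at level `α`. -/
noncomputable def piHG {Ω : Type*} [MeasurableSpace Ω] (μ : Measure Ω)
    (Φ : ℝ → ℝ) (α : ℝ) (X : Ω → ℝ) : ℝ :=
  ⨅ m : ℝ, (m + luxNorm μ (fun x => Φ x / (1 - α)) (fun ω => max (X ω - m) 0))

/-- Feasible dual variables, without the normalisation of the mean. -/
def FeasHG {Ω : Type*} [MeasurableSpace Ω] (μ : Measure Ω) (Θ : ℝ → ℝ) (Y : Ω → ℝ) : Prop :=
  Measurable Y ∧ (∃ C : ℝ, ∀ᵐ ω ∂μ, |Y ω| ≤ C) ∧ (0 : Ω → ℝ) ≤ᵐ[μ] Y ∧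
  (∀ Z : Ω → ℝ, MemOrlicz μ Θ Z → luxNorm μ Θ Z ≤ 1 → |∫ ω, Z ω * Y ω ∂μ| ≤ 1)

lemma subgradHG (Θ : ℝ → ℝ) (h0 : Θ 0 = 0)
    (hm : MonotoneOn Θ (Ici 0)) (hc : ConvexOn ℝ (Ici 0) Θ) :
    ∃ g : ℝ → ℝ, Monotone g ∧ (∀ x ≤ 0, g x = 0) ∧
      ∀ x z, 0 ≤ x → 0 ≤ z → Θ x + g x * (z - x) ≤ Θ z := by
  classical
  have hpos : ∀ x, 0 ≤ x → 0 ≤ Θ x := fun x hx => by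
    rw [← h0]; exact hm (mem_Ici.2 le_rfl) (mem_Ici.2 hx) hx
  set g : ℝ → ℝ := fun x => if 0 < x then derivWithin Θ (Ioi x) x else 0 with hg
  have hsub : ∀ x z, 0 ≤ x → 0 ≤ z → Θ x + g x * (z - x) ≤ Θ z := by
    intro x z hx hz
    rcases hx.eq_or_lt with rfl | hx
    · simp [hg, h0, hpos z hz]
    have hgx : g x = derivWithin Θ (Ioi x) x := by simp [hg, hx]
    have hxi : x ∈ interior (Ici (0:ℝ)) := by rw [interior_Ici]; exact hx
    rcases lt_trichotomy x z with h | h | h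
    · have := hc.rightDeriv_le_slope_of_mem_interior hxi (mem_Ici.2 hz) h
      rw [← hgx, slope_def_field, le_div_iff₀ (by linarith)] at this
      linarith
    · subst h; simp
    · have h1 := hc.slope_le_leftDeriv_of_mem_interior (mem_Ici.2 hz) hxi h
      have h2 := h1.trans (hc.leftDeriv_le_rightDeriv_of_mem_interior hxi)
      rw [← hgx, slope_def_field, div_le_iff₀ (by linarith)] at h2
      linarith
  have hneg : ∀ x ≤ 0, g x = 0 := fun x hx => by simp [hg, not_lt.2 hx]
  have hnn : ∀ x, 0 ≤ g x := by
    intro x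
    rcases le_or_gt x 0 with hx | hx
    · rw [hneg x hx]
    · have h1 := hsub x 0 hx.le le_rfl
      have h2 := hpos x hx.le
      by_contra h
      push Not at h
      nlinarith
  refine ⟨g, ?_, hneg, hsub⟩
  intro x y hxy
  rcases le_or_gt x 0 with hx | hx
  · rw [hneg x hx]; exact hnn y
  rcases hxy.eq_or_lt with rfl | hxy
  · exact le_rfl
  have h1 := hsub x y hx.le (hx.trans hxy).le
  have h2 := hsub y x (hx.trans hxy).le hx.le
  by_contra h
  push Not at h
  nlinarith

lemma measHG {Ω : Type*} [MeasurableSpace Ω] (Θ : ℝ → ℝ) (hm : MonotoneOn Θ (Ici 0))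
    (U : Ω → ℝ) (hU : Measurable U) (hU0 : ∀ ω, 0 ≤ U ω) : Measurable (fun ω => Θ (U ω)) := by
  have h : Monotone (fun x => Θ (max x 0)) := fun x y hxy =>
    hm (mem_Ici.2 (le_max_right _ _)) (mem_Ici.2 (le_max_right _ _)) (max_le_max_right 0 hxy)
  have := h.measurable.comp hU
  convert this using 2 with ω
  simp [hU0 ω]

lemma scaleHG (Θ : ℝ → ℝ) (h0 : Θ 0 = 0) (hc : ConvexOn ℝ (Ici 0) Θ) (x t : ℝ) (hx : 0 ≤ x)
    (ht0 : 0 ≤ t) (ht1 : t ≤ 1) : Θ (t * x) ≤ t * Θ x := by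
  have := hc.2 (mem_Ici.2 hx) (mem_Ici.2 le_rfl) ht0 (sub_nonneg.2 ht1) (by ring)
  simpa [h0] using this

/-- the set in the Luxemburg norm is nonempty -/
lemma nonemptyHG {Ω : Type*} [MeasurableSpace Ω] (μ : Measure Ω) (Θ : ℝ → ℝ) (h0 : Θ 0 = 0)
    (hm : MonotoneOn Θ (Ici 0)) (hc : ConvexOn ℝ (Ici 0) Θ) (Z : Ω → ℝ) (hZ : MemOrlicz μ Θ Z) :
    {l : ℝ | 0 < l ∧ ∫⁻ ω, ENNReal.ofReal (Θ (|Z ω| / l)) ∂μ ≤ 1}.Nonempty := by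
  obtain ⟨hZm, l, hl, hfin⟩ := hZ
  set I := ∫⁻ ω, ENNReal.ofReal (Θ (|Z ω| / l)) ∂μ with hI
  set k : ℝ := I.toReal + 1 with hk
  have hIr : 0 ≤ I.toReal := ENNReal.toReal_nonneg
  have hk1 : 1 ≤ k := by linarith
  have hk0 : 0 < k := by linarith
  refine ⟨l * k, by positivity, ?_⟩
  have hle : ∀ ω, ENNReal.ofReal (Θ (|Z ω| / (l * k))) ≤
      ENNReal.ofReal k⁻¹ * ENNReal.ofReal (Θ (|Z ω| / l)) := by
    intro ω
    rw [← ENNReal.ofReal_mul (by positivity)]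
    apply ENNReal.ofReal_le_ofReal
    have := scaleHG Θ h0 hc (|Z ω| / l) k⁻¹ (by positivity) (by positivity) (inv_le_one_of_one_le₀ hk1)
    convert this using 2
    field_simp
  calc _ ≤ ∫⁻ ω, ENNReal.ofReal k⁻¹ * ENNReal.ofReal (Θ (|Z ω| / l)) ∂μ := lintegral_mono hle
    _ = ENNReal.ofReal k⁻¹ * I := by
      rw [lintegral_const_mul' _ _ ENNReal.ofReal_ne_top]
    _ = ENNReal.ofReal k⁻¹ * ENNReal.ofReal I.toReal := by rw [ENNReal.ofReal_toReal hfin.ne]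
    _ = ENNReal.ofReal (k⁻¹ * I.toReal) := by rw [ENNReal.ofReal_mul (by positivity)]
    _ ≤ 1 := by
      rw [ENNReal.ofReal_le_one, inv_mul_le_iff₀ hk0]; linarith

/-- Orlicz functions dominate, so members are integrable. -/
lemma integrableHG {Ω : Type*} [MeasurableSpace Ω] (μ : Measure Ω) [IsProbabilityMeasure μ]
    (Θ : ℝ → ℝ) (h0 : Θ 0 = 0) (h1 : 1 ≤ Θ 1)
    (hm : MonotoneOn Θ (Ici 0)) (hc : ConvexOn ℝ (Ici 0) Θ) (Z : Ω → ℝ) (hZ : MemOrlicz μ Θ Z) :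
    Integrable Z μ := by
  obtain ⟨hZm, l, hl, hfin⟩ := hZ
  have hpos : ∀ x, 0 ≤ x → 0 ≤ Θ x := fun x hx => by
    rw [← h0]; exact hm (mem_Ici.2 le_rfl) (mem_Ici.2 hx) hx
  have hI : Integrable (fun ω => Θ (|Z ω| / l)) μ := by
    refine ⟨(measHG Θ hm (fun ω => |Z ω| / l) (by fun_prop) (fun ω => by positivity)).aestronglyMeasurable, ?_⟩
    rw [hasFiniteIntegral_iff_ofReal (Eventually.of_forall fun ω => hpos _ (by positivity))]
    exact hfin
  have hI2 : Integrable (fun ω => l * (1 + Θ (|Z ω| / l))) μ := ((integrable_const 1).add hI).const_mul l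
  refine hI2.mono' hZm.aestronglyMeasurable (Eventually.of_forall fun ω => ?_)
  have hx : ∀ x, 0 ≤ x → x ≤ 1 + Θ x := by
    intro x hx
    rcases le_or_gt x 1 with h | h
    · linarith [hpos x hx]
    · have := scaleHG Θ h0 hc x x⁻¹ hx (by positivity) (inv_le_one_of_one_le₀ h.le)
      rw [inv_mul_cancel₀ (by linarith), inv_mul_eq_div, le_div_iff₀ (by linarith)] at this
      nlinarith
  have := hx (|Z ω| / l) (by positivity)
  rw [div_le_iff₀ hl] at this
  rw [Real.norm_eq_abs]; linarith

lemma memHG {Ω : Type*} [MeasurableSpace Ω] (μ : Measure Ω) [IsProbabilityMeasure μ]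
    (Θ : ℝ → ℝ) (h0 : Θ 0 = 0)
    (hm : MonotoneOn Θ (Ici 0)) (hc : ConvexOn ℝ (Ici 0) Θ) (X : Ω → ℝ) (hX : MemOrlicz μ Θ X)
    (m : ℝ) : MemOrlicz μ Θ (fun ω => max (X ω - m) 0) := by
  obtain ⟨hXm, l, hl, hfin⟩ := hX
  have hpos : ∀ x, 0 ≤ x → 0 ≤ Θ x := fun x hx => by
    rw [← h0]; exact hm (mem_Ici.2 le_rfl) (mem_Ici.2 hx) hx
  refine ⟨by fun_prop, 2 * l, by positivity, ?_⟩
  have hle : ∀ ω, ENNReal.ofReal (Θ (|max (X ω - m) 0| / (2 * l))) ≤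
      ENNReal.ofReal (Θ (|X ω| / l)) + ENNReal.ofReal (Θ (|m| / l)) := by
    intro ω
    have p1 := hpos (|X ω| / l) (by positivity)
    have p2 := hpos (|m| / l) (by positivity)
    rw [← ENNReal.ofReal_add p1 p2]
    apply ENNReal.ofReal_le_ofReal
    have q1 : |X ω| / l ∈ Ici (0:ℝ) := mem_Ici.2 (by positivity)
    have q2 : |m| / l ∈ Ici (0:ℝ) := mem_Ici.2 (by positivity)
    have q3 : (0:ℝ) ≤ 1 / 2 := by norm_num
    have q4 : (1:ℝ) / 2 + 1 / 2 = 1 := by norm_num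
    have h2 := hc.2 q1 q2 q3 q3 q4
    simp only [smul_eq_mul] at h2
    have h3 : |max (X ω - m) 0| / (2 * l) ≤ 1 / 2 * (|X ω| / l) + 1 / 2 * (|m| / l) := by
      have : 1 / 2 * (|X ω| / l) + 1 / 2 * (|m| / l) = (|X ω| + |m|) / (2 * l) := by
        field_simp
      rw [this]
      gcongr
      rw [abs_of_nonneg (le_max_right _ _)]
      apply max_le
      · linarith [le_abs_self (X ω), neg_abs_le m]
      · positivity
    have h4 := hm (mem_Ici.2 (by positivity)) (mem_Ici.2 (by positivity)) h3
    linarith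
  refine (lintegral_mono hle).trans_lt ?_
  rw [lintegral_add_right _ measurable_const]
  simp only [lintegral_const, measure_univ, mul_one]
  exact ENNReal.add_lt_top.2 ⟨hfin, ENNReal.ofReal_lt_top⟩

/-- Existence of a nearly norming dual variable. -/
lemma normingHG {Ω : Type*} [MeasurableSpace Ω] (μ : Measure Ω) [IsProbabilityMeasure μ]
    (Θ : ℝ → ℝ) (h0 : Θ 0 = 0) (h1 : 1 ≤ Θ 1)
    (hm : MonotoneOn Θ (Ici 0)) (hc : ConvexOn ℝ (Ici 0) Θ) (U : Ω → ℝ) (hU : Measurable U)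
    (hU0 : ∀ ω, 0 ≤ U ω) (K : ℝ) (hUK : ∀ ω, U ω ≤ K)
    (hbig : 1 < ∫⁻ ω, ENNReal.ofReal (Θ (U ω)) ∂μ) :
    ∃ Y, FeasHG μ Θ Y ∧ (∀ ω, 0 ≤ Y ω) ∧ (∀ ω, U ω = 0 → Y ω = 0) ∧ 1 < ∫ ω, U ω * Y ω ∂μ := by
  have hpos : ∀ x, 0 ≤ x → 0 ≤ Θ x := fun x hx => by
    rw [← h0]; exact hm (mem_Ici.2 le_rfl) (mem_Ici.2 hx) hx
  obtain ⟨g, hg, hg0, hsub⟩ := subgradHG Θ h0 hm hc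
  have hgnn : ∀ x, 0 ≤ g x := fun x => by
    rcases le_or_gt x 0 with hx | hx
    · rw [hg0 x hx]
    · rw [← hg0 0 le_rfl]; exact hg hx.le
  have mG : Measurable (fun ω => g (U ω)) := hg.measurable.comp hU
  have mT : Measurable (fun ω => Θ (U ω)) := measHG Θ hm U hU hU0
  have bG : ∀ ω, |g (U ω)| ≤ g K := fun ω => by
    rw [abs_of_nonneg (hgnn _)]; exact hg (hUK ω)
  have iT : Integrable (fun ω => Θ (U ω)) μ := by
    refine Integrable.of_bound mT.aestronglyMeasurable (Θ K) (Eventually.of_forall fun ω => ?_)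
    rw [Real.norm_eq_abs, abs_of_nonneg (hpos _ (hU0 ω))]
    exact hm (hU0 ω) ((hU0 ω).trans (hUK ω)) (hUK ω)
  have iUG : Integrable (fun ω => U ω * g (U ω)) μ := by
    refine Integrable.of_bound (hU.mul mG).aestronglyMeasurable (K * g K)
      (Eventually.of_forall fun ω => ?_)
    rw [norm_mul, Real.norm_eq_abs, Real.norm_eq_abs, abs_of_nonneg (hU0 ω)]
    exact mul_le_mul (hUK ω) (bG ω) (abs_nonneg _) ((hU0 ω).trans (hUK ω))
  have hT1 : 1 < ∫ ω, Θ (U ω) ∂μ := by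
    rw [← ofReal_integral_eq_lintegral_ofReal iT (Eventually.of_forall fun ω => hpos _ (hU0 ω))] at hbig
    exact ENNReal.one_lt_ofReal.1 hbig
  set h : Ω → ℝ := fun ω => U ω * g (U ω) - Θ (U ω) with hh
  have ih : Integrable h μ := iUG.sub iT
  have hh0 : ∀ ω, 0 ≤ h ω := fun ω => by
    have := hsub (U ω) 0 (hU0 ω) le_rfl
    rw [h0] at this
    simp only [hh]; nlinarith
  have hhi : ∫ ω, h ω ∂μ = ∫ ω, U ω * g (U ω) ∂μ - ∫ ω, Θ (U ω) ∂μ := integral_sub iUG iT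
  have hhi0 : 0 ≤ ∫ ω, h ω ∂μ := integral_nonneg hh0
  set κ : ℝ := 1 + ∫ ω, h ω ∂μ with hκ
  have hκ0 : 0 < κ := by linarith
  refine ⟨fun ω => g (U ω) / κ, ⟨mG.div_const κ, ⟨g K / κ, Eventually.of_forall fun ω => ?_⟩,
    Eventually.of_forall fun ω => div_nonneg (hgnn _) hκ0.le, ?_⟩,
    fun ω => div_nonneg (hgnn _) hκ0.le, ?_, ?_⟩
  · rw [abs_div, abs_of_pos hκ0]; gcongr; exact bG ω
  · intro Z hZ hZ1
    have hne := nonemptyHG μ Θ h0 hm hc Z hZ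
    have hZi := integrableHG μ Θ h0 h1 hm hc Z hZ
    have key : ∀ l' : ℝ, 1 < l' → |∫ ω, Z ω * (g (U ω) / κ) ∂μ| ≤ l' := by
      intro l' hl'
      obtain ⟨l, ⟨hl0, hlI⟩, hll'⟩ := exists_lt_of_csInf_lt hne (lt_of_le_of_lt hZ1 hl')
      have mZ : Measurable (fun ω => Θ (|Z ω| / l)) :=
        measHG Θ hm (fun ω => |Z ω| / l) (by have := hZ.1; fun_prop) (fun ω => by positivity)
      have pZ : ∀ ω, 0 ≤ Θ (|Z ω| / l) := fun ω => hpos _ (by positivity)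
      have iZ : Integrable (fun ω => Θ (|Z ω| / l)) μ := by
        refine ⟨mZ.aestronglyMeasurable, ?_⟩
        rw [hasFiniteIntegral_iff_ofReal (Eventually.of_forall pZ)]
        exact hlI.trans_lt ENNReal.one_lt_top
      have iZ1 : ∫ ω, Θ (|Z ω| / l) ∂μ ≤ 1 := by
        rw [← ofReal_integral_eq_lintegral_ofReal iZ (Eventually.of_forall pZ)] at hlI
        exact ENNReal.ofReal_le_one.1 hlI
      have hpt : ∀ ω, ‖Z ω * (g (U ω) / κ)‖ ≤ l / κ * (Θ (|Z ω| / l) + h ω) := by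
        intro ω
        have := hsub (U ω) (|Z ω| / l) (hU0 ω) (by positivity)
        have h3 : |Z ω| / l * g (U ω) ≤ Θ (|Z ω| / l) + h ω := by
          simp only [hh]; nlinarith
        rw [norm_mul, Real.norm_eq_abs, Real.norm_eq_abs, abs_div, abs_of_pos hκ0,
          abs_of_nonneg (hgnn _)]
        calc |Z ω| * (g (U ω) / κ) = l / κ * (|Z ω| / l * g (U ω)) := by field_simp
          _ ≤ _ := by gcongr
      calc |∫ ω, Z ω * (g (U ω) / κ) ∂μ| ≤ ∫ ω, l / κ * (Θ (|Z ω| / l) + h ω) ∂μ :=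
            norm_integral_le_of_norm_le ((iZ.add ih).const_mul _) (Eventually.of_forall hpt)
        _ = l / κ * (∫ ω, Θ (|Z ω| / l) ∂μ + ∫ ω, h ω ∂μ) := by
            rw [integral_const_mul, integral_add iZ ih]
        _ ≤ l / κ * κ := by gcongr; linarith
        _ = l := by field_simp
        _ ≤ l' := hll'.le
    exact le_of_forall_gt_imp_ge_of_dense key
  · intro ω hω
    simp [hω, hg0]
  · have : ∀ ω, U ω * (g (U ω) / κ) = (U ω * g (U ω)) / κ := fun ω => by ring
    simp_rw [this]
    rw [integral_div, lt_div_iff₀ hκ0]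
    linarith

lemma feasIntHG {Ω : Type*} [MeasurableSpace Ω] (μ : Measure Ω)
    (Θ : ℝ → ℝ) (Y Z : Ω → ℝ) (hY : FeasHG μ Θ Y) (hZ : Integrable Z μ) :
    Integrable (fun ω => Z ω * Y ω) μ := by
  obtain ⟨hYm, ⟨C, hC⟩, -, -⟩ := hY
  exact hZ.mul_bdd (c := C) hYm.aestronglyMeasurable hC

/-- Easy half of duality for the norm. -/
lemma easyHG {Ω : Type*} [MeasurableSpace Ω] (μ : Measure Ω) [IsProbabilityMeasure μ]
    (Θ : ℝ → ℝ) (h0 : Θ 0 = 0)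
    (hm : MonotoneOn Θ (Ici 0)) (hc : ConvexOn ℝ (Ici 0) Θ) (Y W : Ω → ℝ)
    (hY : FeasHG μ Θ Y) (hW : MemOrlicz μ Θ W) : ∫ ω, W ω * Y ω ∂μ ≤ luxNorm μ Θ W := by
  apply le_csInf (nonemptyHG μ Θ h0 hm hc W hW)
  rintro l ⟨hl, hlI⟩
  have hmem : ∫⁻ ω, ENNReal.ofReal (Θ (|W ω / l| / 1)) ∂μ ≤ 1 := by
    simpa [abs_div, abs_of_pos hl] using hlI
  have h := hY.2.2.2 (fun ω => W ω / l) ⟨hW.1.div_const l, 1, one_pos, hmem.trans_lt ENNReal.one_lt_top⟩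
    (csInf_le ⟨0, fun x hx => hx.1.le⟩ ⟨one_pos, hmem⟩)
  have h2 : ∫ ω, W ω / l * Y ω ∂μ = (∫ ω, W ω * Y ω ∂μ) / l := by
    rw [← integral_div]; congr 1; ext ω; ring
  rw [h2] at h
  have h3 := (le_abs_self _).trans h
  rwa [div_le_one hl] at h3

lemma feasConvHG {Ω : Type*} [MeasurableSpace Ω] (μ : Measure Ω) [IsProbabilityMeasure μ]
    (Θ : ℝ → ℝ) (h0 : Θ 0 = 0) (h1 : 1 ≤ Θ 1)
    (hm : MonotoneOn Θ (Ici 0)) (hc : ConvexOn ℝ (Ici 0) Θ) (Y₁ Y₂ : Ω → ℝ)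
    (hY₁ : FeasHG μ Θ Y₁) (hY₂ : FeasHG μ Θ Y₂) (a b : ℝ) (ha : 0 ≤ a) (hb : 0 ≤ b)
    (hab : a + b ≤ 1) : FeasHG μ Θ (fun ω => a * Y₁ ω + b * Y₂ ω) := by
  have hA := hY₁
  have hB := hY₂
  obtain ⟨m1, ⟨C1, hC1⟩, p1, d1⟩ := hY₁
  obtain ⟨m2, ⟨C2, hC2⟩, p2, d2⟩ := hY₂
  refine ⟨by fun_prop, ⟨a * C1 + b * C2, ?_⟩, ?_, ?_⟩
  · filter_upwards [hC1, hC2] with ω h1 h2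
    refine (abs_add_le _ _).trans ?_
    rw [abs_mul, abs_mul, abs_of_nonneg ha, abs_of_nonneg hb]
    gcongr
  · filter_upwards [p1, p2] with ω h1 h2
    simp only [Pi.zero_apply] at *
    positivity
  · intro Z hZ hZ1
    have hZi := integrableHG μ Θ h0 h1 hm hc Z hZ
    have i1 := feasIntHG μ Θ Y₁ Z hA hZi
    have i2 := feasIntHG μ Θ Y₂ Z hB hZi
    have : ∫ ω, Z ω * (a * Y₁ ω + b * Y₂ ω) ∂μ = a * ∫ ω, Z ω * Y₁ ω ∂μ + b * ∫ ω, Z ω * Y₂ ω ∂μ := by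
      rw [← integral_const_mul, ← integral_const_mul, ← integral_add (i1.const_mul a) (i2.const_mul b)]
      congr 1; ext ω; ring
    rw [this]
    refine (abs_add_le _ _).trans ?_
    rw [abs_mul, abs_mul, abs_of_nonneg ha, abs_of_nonneg hb]
    nlinarith [d1 Z hZ hZ1, d2 Z hZ hZ1]

/-- Duality for the norm of the positive part. -/
lemma hardHG {Ω : Type*} [MeasurableSpace Ω] (μ : Measure Ω) [IsProbabilityMeasure μ]
    (Θ : ℝ → ℝ) (h0 : Θ 0 = 0) (h1 : 1 ≤ Θ 1)
    (hm : MonotoneOn Θ (Ici 0)) (hc : ConvexOn ℝ (Ici 0) Θ) (V : Ω → ℝ) (hV : Measurable V)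
    (hVi : Integrable V μ) (c : ℝ) (hc0 : 0 ≤ c)
    (hcV : ∀ Y, FeasHG μ Θ Y → ∫ ω, V ω * Y ω ∂μ ≤ c) :
    luxNorm μ Θ (fun ω => max (V ω) 0) ≤ c := by
  have hpos : ∀ x, 0 ≤ x → 0 ≤ Θ x := fun x hx => by
    rw [← h0]; exact hm (mem_Ici.2 le_rfl) (mem_Ici.2 hx) hx
  apply le_of_forall_gt_imp_ge_of_dense
  intro l hl
  have hl0 : 0 < l := by linarith
  refine csInf_le ⟨0, fun x hx => hx.1.le⟩ ⟨hl0, ?_⟩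
  by_contra hbig
  push Not at hbig
  set U : ℕ → Ω → ℝ := fun n ω => min (max (V ω) 0) (n + 1) / l with hUdef
  have hUm : ∀ n, Measurable (U n) := fun n => by simp only [hUdef]; fun_prop
  have hU0 : ∀ n ω, 0 ≤ U n ω := fun n ω =>
    div_nonneg (le_min (le_max_right _ _) (by positivity)) hl0.le
  have hlim : Tendsto (fun n => ∫⁻ ω, ENNReal.ofReal (Θ (U n ω)) ∂μ) atTop
      (𝓝 (∫⁻ ω, ENNReal.ofReal (Θ (|max (V ω) 0| / l)) ∂μ)) := by
    apply lintegral_tendsto_of_tendsto_of_monotone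
    · intro n
      exact (measHG Θ hm (U n) (hUm n) (hU0 n)).ennreal_ofReal.aemeasurable
    · refine Eventually.of_forall fun ω n k hnk => ENNReal.ofReal_le_ofReal ?_
      refine hm (hU0 n ω) (hU0 k ω) ?_
      simp only [hUdef]
      gcongr
    · refine Eventually.of_forall fun ω => ?_
      apply tendsto_const_nhds.congr'
      obtain ⟨N, hN⟩ := exists_nat_ge (max (V ω) 0)
      filter_upwards [eventually_ge_atTop N] with n hn
      have : (N : ℝ) ≤ n := by exact_mod_cast hn
      simp only [hUdef]
      rw [abs_of_nonneg (le_max_right _ _), min_eq_left (by linarith)]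
  obtain ⟨n, hn⟩ := (hlim.eventually (lt_mem_nhds hbig)).exists
  obtain ⟨Y, hY, hYnn, hYz, hY1⟩ := normingHG μ Θ h0 h1 hm hc (U n) (hUm n) (hU0 n) ((n + 1) / l)
    (fun ω => by simp only [hUdef]; gcongr; exact min_le_right _ _) hn
  have hpt : ∀ ω, U n ω * Y ω ≤ (V ω * Y ω) / l := by
    intro ω
    rcases le_or_gt (V ω) 0 with h | h
    · have hz : U n ω = 0 := by
        simp only [hUdef]
        rw [max_eq_right h, min_eq_left (by positivity), zero_div]
      rw [hz, hYz ω hz]; simp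
    · rw [mul_div_right_comm]
      refine mul_le_mul_of_nonneg_right ?_ (hYnn ω)
      simp only [hUdef]
      gcongr
      rw [max_eq_left h.le]
      exact min_le_left _ _
  have iVY := feasIntHG μ Θ Y V hY hVi
  have h4 : ∫ ω, U n ω * Y ω ∂μ ≤ ∫ ω, (V ω * Y ω) / l ∂μ := by
    refine integral_mono_of_nonneg (Eventually.of_forall fun ω => mul_nonneg (hU0 n ω) (hYnn ω))
      (iVY.div_const l) (Eventually.of_forall hpt)
  rw [integral_div] at h4
  have h5 := hY1.trans_le h4
  rw [lt_div_iff₀ hl0] at h5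
  linarith [hcV Y hY]

/-- The supporting line argument. -/
lemma supportHG (P : ℝ → ℝ → Prop) (S : ℝ) (hS : ∀ a, P 1 a → a ≤ S)
    (hconv : ∀ t₁ a₁ t₂ a₂ θ, P t₁ a₁ → P t₂ a₂ → 0 ≤ θ → θ ≤ 1 →
      P (θ * t₁ + (1 - θ) * t₂) (θ * a₁ + (1 - θ) * a₂))
    (hlo : ∃ t a, t < 1 ∧ P t a) (hhi : ∃ t a, 1 < t ∧ P t a) :
    ∃ m : ℝ, ∀ t a, P t a → a + m * (1 - t) ≤ S := by
  have hcross : ∀ t₁ a₁ t₂ a₂, P t₁ a₁ → P t₂ a₂ → t₁ < 1 → 1 < t₂ →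
      (a₁ - S) / (1 - t₁) ≤ (S - a₂) / (t₂ - 1) := by
    intro t₁ a₁ t₂ a₂ p1 p2 h1 h2
    have hd : 0 < t₂ - t₁ := by linarith
    have h3 := hconv t₁ a₁ t₂ a₂ ((t₂ - 1) / (t₂ - t₁)) p1 p2
      (div_nonneg (by linarith) hd.le) ((div_le_one hd).2 (by linarith))
    have e1 : (t₂ - 1) / (t₂ - t₁) * t₁ + (1 - (t₂ - 1) / (t₂ - t₁)) * t₂ = 1 := by
      field_simp; ring
    rw [e1] at h3
    have h4 := hS _ h3
    have e2 : (t₂ - 1) / (t₂ - t₁) * a₁ + (1 - (t₂ - 1) / (t₂ - t₁)) * a₂ =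
        ((t₂ - 1) * a₁ + (1 - t₁) * a₂) / (t₂ - t₁) := by field_simp; ring
    rw [e2, div_le_iff₀ hd] at h4
    rw [div_le_div_iff₀ (by linarith) (by linarith)]
    linarith
  obtain ⟨t₀, a₀, ht₀, hp₀⟩ := hlo
  obtain ⟨t₃, a₃, ht₃, hp₃⟩ := hhi
  set A : Set ℝ := {s | ∃ t a, t < 1 ∧ P t a ∧ s = (a - S) / (1 - t)} with hA
  have hne : A.Nonempty := ⟨_, t₀, a₀, ht₀, hp₀, rfl⟩
  have hbdd : BddAbove A := ⟨(S - a₃) / (t₃ - 1), by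
    rintro s ⟨t, a, ht, hp, rfl⟩; exact hcross _ _ _ _ hp hp₃ ht ht₃⟩
  refine ⟨-sSup A, fun t a hp => ?_⟩
  rcases lt_trichotomy t 1 with h | h | h
  · have := le_csSup hbdd ⟨t, a, h, hp, rfl⟩
    rw [div_le_iff₀ (by linarith)] at this
    linarith
  · subst h; linarith [hS a hp]
  · have : sSup A ≤ (S - a) / (t - 1) := csSup_le hne (by
      rintro s ⟨t', a', ht, hp', rfl⟩; exact hcross _ _ _ _ hp' hp ht h)
    rw [le_div_iff₀ (by linarith)] at this
    linarith

/-- Dual representation of the Haezendonck–Goovaerts premium principle: for every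
`X ∈ L^Φ`, `π_α(X)` is the supremum of `E[XY]` over all bounded `Y ≥ 0` with `E[Y] = 1`
and Orlicz norm `‖Y‖_{Ψ_α} ≤ 1` (expressed by duality against the unit ball of the
`Φ_α`-Luxemburg norm); equivalently, the supremum of `E_ℚ[X]` over all probability
measures `ℚ ≪ ℙ` with bounded density `Y = dℚ/dℙ` satisfying `‖Y‖_{Ψ_α} ≤ 1`. -/
theorem stmt_16 {Ω : Type*} [MeasurableSpace Ω] (μ : Measure Ω) [IsProbabilityMeasure μ]
    (hNA : ∀ A : Set Ω, MeasurableSet A → 0 < μ A →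
      ∃ B : Set Ω, B ⊆ A ∧ MeasurableSet B ∧ 0 < μ B ∧ μ B < μ A)
    (Φ : ℝ → ℝ) (hΦ0 : Φ 0 = 0) (hΦ1 : Φ 1 = 1)
    (hΦmono : MonotoneOn Φ (Ici 0)) (hΦconv : ConvexOn ℝ (Ici 0) Φ)
    (α : ℝ) (hα : α ∈ Ioo (0 : ℝ) 1)
    (X : Ω → ℝ) (hX : MemOrlicz μ Φ X) :
    piHG μ Φ α X = sSup {r : ℝ | ∃ Y : Ω → ℝ,
      Measurable Y ∧
      (∃ C : ℝ, ∀ᵐ ω ∂μ, |Y ω| ≤ C) ∧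
      (0 : Ω → ℝ) ≤ᵐ[μ] Y ∧
      (∫ ω, Y ω ∂μ) = 1 ∧
      (∀ Z : Ω → ℝ, MemOrlicz μ (fun x => Φ x / (1 - α)) Z →
        luxNorm μ (fun x => Φ x / (1 - α)) Z ≤ 1 → |∫ ω, Z ω * Y ω ∂μ| ≤ 1) ∧
      r = ∫ ω, X ω * Y ω ∂μ} := by
  obtain ⟨hα0, hα1⟩ := hα
  have hd : 0 < 1 - α := by linarith
  set Θ : ℝ → ℝ := fun x => Φ x / (1 - α) with hΘ
  have h0 : Θ 0 = 0 := by simp [hΘ, hΦ0]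
  have h1' : 1 < Θ 1 := by
    simp only [hΘ, hΦ1]; rw [lt_div_iff₀ hd]; linarith
  have h1 := h1'.le
  have hm : MonotoneOn Θ (Ici 0) := fun x hx y hy hxy =>
    div_le_div_of_nonneg_right (hΦmono hx hy hxy) hd.le
  have hc : ConvexOn ℝ (Ici 0) Θ := by
    have := hΦconv.smul (c := (1 - α)⁻¹) (by positivity)
    have e : Θ = fun x => (1 - α)⁻¹ • Φ x := by
      ext x; simp [hΘ, div_eq_inv_mul]
    rw [e]; exact this
  have hXΘ : MemOrlicz μ Θ X := by
    obtain ⟨hXm, l, hl, hfin⟩ := hX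
    refine ⟨hXm, l, hl, ?_⟩
    have : ∀ ω, ENNReal.ofReal (Θ (|X ω| / l)) =
        ENNReal.ofReal (1 - α)⁻¹ * ENNReal.ofReal (Φ (|X ω| / l)) := fun ω => by
      rw [← ENNReal.ofReal_mul (by positivity)]; simp only [hΘ, div_eq_inv_mul]
    simp_rw [this]
    rw [lintegral_const_mul' _ _ ENNReal.ofReal_ne_top]
    exact ENNReal.mul_lt_top ENNReal.ofReal_lt_top hfin
  have hXi := integrableHG μ Θ h0 h1 hm hc X hXΘ
  have hYi : ∀ Y, FeasHG μ Θ Y → Integrable Y μ := fun Y hY => by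
    have := feasIntHG μ Θ Y (fun _ => 1) hY (integrable_const 1)
    simpa using this
  -- weak duality
  have weak : ∀ Y, FeasHG μ Θ Y → ∫ ω, Y ω ∂μ = 1 → ∀ m : ℝ,
      ∫ ω, X ω * Y ω ∂μ ≤ m + luxNorm μ Θ (fun ω => max (X ω - m) 0) := by
    intro Y hY hY1 m
    have hW := memHG μ Θ h0 hm hc X hXΘ m
    have hWi := integrableHG μ Θ h0 h1 hm hc _ hW
    have e := easyHG μ Θ h0 hm hc Y _ hY hW
    have hle : ∫ ω, X ω * Y ω ∂μ ≤ ∫ ω, (m * Y ω + max (X ω - m) 0 * Y ω) ∂μ := by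
      refine integral_mono_ae (feasIntHG μ Θ Y X hY hXi)
        (((hYi Y hY).const_mul m).add (feasIntHG μ Θ Y _ hY hWi)) ?_
      filter_upwards [hY.2.2.1] with ω hω
      simp only [Pi.zero_apply] at hω
      nlinarith [le_max_left (X ω - m) 0]
    rw [integral_add ((hYi Y hY).const_mul m) (feasIntHG μ Θ Y _ hY hWi), integral_const_mul,
      hY1] at hle
    linarith
  -- a feasible element of mean larger than one
  obtain ⟨Y₀, hY₀, -, -, hY₀1⟩ := normingHG μ Θ h0 h1 hm hc (fun _ => 1) measurable_const
    (fun _ => zero_le_one) 1 (fun _ => le_rfl) (by simpa using h1')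
  simp only [one_mul] at hY₀1
  have hzero : FeasHG μ Θ (fun _ => 0) :=
    ⟨measurable_const, ⟨0, by simp⟩, Eventually.of_forall fun _ => le_rfl, by simp⟩
  set T : Set ℝ := {r : ℝ | ∃ Y : Ω → ℝ,
      Measurable Y ∧
      (∃ C : ℝ, ∀ᵐ ω ∂μ, |Y ω| ≤ C) ∧
      (0 : Ω → ℝ) ≤ᵐ[μ] Y ∧
      (∫ ω, Y ω ∂μ) = 1 ∧
      (∀ Z : Ω → ℝ, MemOrlicz μ Θ Z →
        luxNorm μ Θ Z ≤ 1 → |∫ ω, Z ω * Y ω ∂μ| ≤ 1) ∧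
      r = ∫ ω, X ω * Y ω ∂μ} with hT
  have hTmem : ∀ r, r ∈ T ↔ ∃ Y, FeasHG μ Θ Y ∧ ∫ ω, Y ω ∂μ = 1 ∧ r = ∫ ω, X ω * Y ω ∂μ := by
    intro r
    constructor
    · rintro ⟨Y, a, b, c, d, e, f⟩; exact ⟨Y, ⟨a, b, c, e⟩, d, f⟩
    · rintro ⟨Y, ⟨a, b, c, e⟩, d, f⟩; exact ⟨Y, a, b, c, d, e, f⟩
  have hTne : T.Nonempty := by
    have hp : 0 < ∫ ω, Y₀ ω ∂μ := by linarith
    refine ⟨_, (hTmem _).2 ⟨_, feasConvHG μ Θ h0 h1 hm hc Y₀ _ hY₀ hzero (∫ ω, Y₀ ω ∂μ)⁻¹ 0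
      (by positivity) le_rfl (by rw [add_zero]; exact inv_le_one_of_one_le₀ hY₀1.le), ?_, rfl⟩⟩
    simp only [mul_zero, add_zero]
    rw [integral_const_mul, inv_mul_cancel₀ hp.ne']
  have hTle : ∀ r ∈ T, ∀ m : ℝ, r ≤ m + luxNorm μ Θ (fun ω => max (X ω - m) 0) := by
    intro r hr m
    obtain ⟨Y, hY, hY1, rfl⟩ := (hTmem r).1 hr
    exact weak Y hY hY1 m
  have hTbdd : BddAbove T := ⟨_, fun r hr => hTle r hr 0⟩
  have hpi : piHG μ Φ α X = ⨅ m : ℝ, (m + luxNorm μ Θ (fun ω => max (X ω - m) 0)) := rfl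
  rw [hpi]
  apply le_antisymm
  · obtain ⟨m, hmS⟩ := supportHG
      (fun t a => ∃ Y, FeasHG μ Θ Y ∧ ∫ ω, Y ω ∂μ = t ∧ a = ∫ ω, X ω * Y ω ∂μ) (sSup T)
      (fun a ha => le_csSup hTbdd ((hTmem a).2 ha))
      (by
        rintro t₁ a₁ t₂ a₂ θ ⟨Y₁, hY₁, rfl, rfl⟩ ⟨Y₂, hY₂, rfl, rfl⟩ hθ0 hθ1
        refine ⟨_, feasConvHG μ Θ h0 h1 hm hc Y₁ Y₂ hY₁ hY₂ θ (1 - θ) hθ0 (by linarith)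
          (by linarith), ?_, ?_⟩
        · rw [integral_add ((hYi _ hY₁).const_mul _) ((hYi _ hY₂).const_mul _),
            integral_const_mul, integral_const_mul]
        · rw [← integral_const_mul, ← integral_const_mul,
            ← integral_add ((feasIntHG μ Θ _ X hY₁ hXi).const_mul _)
              ((feasIntHG μ Θ _ X hY₂ hXi).const_mul _)]
          congr 1; ext ω; ring)
      ⟨0, 0, one_pos, _, hzero, by simp, by simp⟩
      ⟨_, _, hY₀1, Y₀, hY₀, rfl, rfl⟩
    obtain ⟨r₀, hr₀⟩ := hTne
    refine (ciInf_le ⟨r₀, ?_⟩ m).trans ?_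
    · rintro _ ⟨m', rfl⟩; exact hTle r₀ hr₀ m'
    have hcm : ∀ Y, FeasHG μ Θ Y → ∫ ω, (X ω - m) * Y ω ∂μ ≤ sSup T - m := by
      intro Y hY
      have := hmS _ _ ⟨Y, hY, rfl, rfl⟩
      have e : ∫ ω, (X ω - m) * Y ω ∂μ = ∫ ω, X ω * Y ω ∂μ - m * ∫ ω, Y ω ∂μ := by
        rw [← integral_const_mul, ← integral_sub (feasIntHG μ Θ Y X hY hXi) ((hYi Y hY).const_mul m)]
        congr 1; ext ω; ring
      rw [e]; linarith
    have h00 : 0 ≤ sSup T - m := by simpa using hcm _ hzero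
    have := hardHG μ Θ h0 h1 hm hc (fun ω => X ω - m) (hXΘ.1.sub_const m)
      (hXi.sub (integrable_const m)) (sSup T - m) h00 hcm
    linarith
  · exact le_ciInf fun m => csSup_le hTne fun r hr => hTle r hr m
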